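/- Cartan decomposition for the non-symmetric reductive spherical pair (Spin(7,ℂ), G_2(ℂ)) of rank-one type: for every g ∈ B_3(ℂ) there exist k ∈ Spin(7), θ ∈ ℝ, and h ∈ G_2(ℂ) such that g = k ã_θ h. That is, Spin(7,ℂ) = Spin(7) · Ã_0 · G_2(ℂ), where Ã_0 = {ã_θ : θ ∈ ℝ}. -/

import Mathlib

open Matrix

noncomputable section

/-- The standard basis of the complexified Cayley algebra `𝕆_ℂ = ℂ^8`. -/
def e (i : Fin 8) : Fin 8 → ℂ := Pi.single i 1

/-- The oriented lines of the multiplication table of the Cayley algebra: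
`(i, j, k)` in this list means `e_i e_j = e_k`. -/
def octLines : List (Fin 8 × Fin 8 × Fin 8) :=
  [(1,2,3),(2,3,1),(3,1,2),
   (1,4,5),(4,5,1),(5,1,4),
   (1,6,7),(6,7,1),(7,1,6),
   (2,5,7),(5,7,2),(7,2,5),
   (2,6,4),(6,4,2),(4,2,6),
   (3,5,6),(5,6,3),(6,3,5),
   (3,4,7),(4,7,3),(7,3,4)]

/-- Product of two basis elements of the complexified Cayley algebra. -/
def octBasisMul (i j : Fin 8) : Fin 8 → ℂ :=
  if i = 0 then e j
  else if j = 0 then e i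
  else if i = j then -(e 0)
  else
    match octLines.find? (fun t => t.1 == i && t.2.1 == j) with
    | some t => e t.2.2
    | none =>
      match octLines.find? (fun t => t.1 == j && t.2.1 == i) with
      | some t => -(e t.2.2)
      | none => 0

/-- The bilinear multiplication of the complexified Cayley algebra `𝕆_ℂ`. -/
def octMul (x y : Fin 8 → ℂ) : Fin 8 → ℂ :=
  ∑ i, ∑ j, (x i * y j) • octBasisMul i j

/-- The standard symmetric bilinear form on `ℂ^8`. -/
def bform (v w : Fin 8 → ℂ) : ℂ := ∑ i, v i * w i

/-- `SO(8, ℂ)`. -/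
def SO8 (g : Matrix (Fin 8) (Fin 8) ℂ) : Prop := gᵀ * g = 1 ∧ g.det = 1

/-- A matrix has real entries. -/
def realMat (g : Matrix (Fin 8) (Fin 8) ℂ) : Prop := ∀ i j, (g i j).im = 0

/-- The realization of `G₂(ℂ)` as automorphisms of `𝕆_ℂ`. -/
def inG2 (g : Matrix (Fin 8) (Fin 8) ℂ) : Prop :=
  SO8 g ∧ ∀ x y, g.mulVec (octMul x y) = octMul (g.mulVec x) (g.mulVec y)

/-- The compact real form `G₂`. -/
def inG2cpt (g : Matrix (Fin 8) (Fin 8) ℂ) : Prop := inG2 g ∧ realMat g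

/-- The realization `B₃(ℂ)` of `Spin(7, ℂ)`. -/
def inB3 (g : Matrix (Fin 8) (Fin 8) ℂ) : Prop :=
  SO8 g ∧ ∃ g₀, SO8 g₀ ∧ g₀.mulVec (e 0) = e 0 ∧
    ∀ x y, octMul (g₀.mulVec x) (g.mulVec y) = g.mulVec (octMul x y)

/-- The compact real form `Spin(7)`. -/
def inSpin7 (g : Matrix (Fin 8) (Fin 8) ℂ) : Prop :=
  SO8 g ∧ realMat g ∧ ∃ g₀, SO8 g₀ ∧ realMat g₀ ∧ g₀.mulVec (e 0) = e 0 ∧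
    ∀ x y, octMul (g₀.mulVec x) (g.mulVec y) = g.mulVec (octMul x y)

/-- The one-parameter group `t_θ` (abelian slice `A₁` for `(G₂(ℂ), SL(3,ℂ))`). -/
def tmat (θ : ℝ) : Matrix (Fin 8) (Fin 8) ℂ :=
  Matrix.of fun i j =>
    (![ e 0,
        (Real.cosh θ : ℂ) • e 1 + (Complex.I * (Real.sinh θ : ℂ)) • e 2,
        (-(Complex.I * (Real.sinh θ : ℂ))) • e 1 + (Real.cosh θ : ℂ) • e 2,
        e 3,
        (Real.cosh (θ/2) : ℂ) • e 4 + (-(Complex.I * (Real.sinh (θ/2) : ℂ))) • e 7,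
        (Real.cosh (θ/2) : ℂ) • e 5 + (-(Complex.I * (Real.sinh (θ/2) : ℂ))) • e 6,
        (Complex.I * (Real.sinh (θ/2) : ℂ)) • e 5 + (Real.cosh (θ/2) : ℂ) • e 6,
        (Complex.I * (Real.sinh (θ/2) : ℂ)) • e 4 + (Real.cosh (θ/2) : ℂ) • e 7 ] j) i

/-- The generator `τ₁` of the one-parameter group `A₁`, i.e. `exp (θ τ₁) = t_θ`. -/
def tau1 : Matrix (Fin 8) (Fin 8) ℂ :=
  Matrix.of fun i j =>
    (![ 0,
        Complex.I • e 2,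
        (-Complex.I) • e 1,
        0,
        (-(Complex.I/2)) • e 7,
        (-(Complex.I/2)) • e 6,
        (Complex.I/2) • e 5,
        (Complex.I/2) • e 4 ] j) i

/-- The one-parameter group `ã_θ` (abelian slice `Ã₀` for `(Spin(7,ℂ), G₂(ℂ))`). -/
def atil (θ : ℝ) : Matrix (Fin 8) (Fin 8) ℂ :=
  Matrix.of fun i j =>
    (![ (Real.cosh θ : ℂ) • e 0 + (Complex.I * (Real.sinh θ : ℂ)) • e 1,
        (-(Complex.I * (Real.sinh θ : ℂ))) • e 0 + (Real.cosh θ : ℂ) • e 1,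
        (Real.cosh (θ/3) : ℂ) • e 2 + (-(Complex.I * (Real.sinh (θ/3) : ℂ))) • e 3,
        (Complex.I * (Real.sinh (θ/3) : ℂ)) • e 2 + (Real.cosh (θ/3) : ℂ) • e 3,
        (Real.cosh (θ/3) : ℂ) • e 4 + (-(Complex.I * (Real.sinh (θ/3) : ℂ))) • e 5,
        (Complex.I * (Real.sinh (θ/3) : ℂ)) • e 4 + (Real.cosh (θ/3) : ℂ) • e 5,
        (Real.cosh (θ/3) : ℂ) • e 6 + (-(Complex.I * (Real.sinh (θ/3) : ℂ))) • e 7,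
        (Complex.I * (Real.sinh (θ/3) : ℂ)) • e 6 + (Real.cosh (θ/3) : ℂ) • e 7 ] j) i

/-- The generator `α̃₁` of the one-parameter group `Ã₀`, i.e. `exp (θ α̃₁) = ã_θ`. -/
def alphatil1 : Matrix (Fin 8) (Fin 8) ℂ :=
  Matrix.of fun i j =>
    (![ Complex.I • e 1,
        (-Complex.I) • e 0,
        (-(Complex.I/3)) • e 3,
        (Complex.I/3) • e 2,
        (-(Complex.I/3)) • e 5,
        (Complex.I/3) • e 4,
        (-(Complex.I/3)) • e 7,
        (Complex.I/3) • e 6 ] j) i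

/-- The one-parameter group `a_x` (abelian slice `A₀` for `(SO(7,ℂ), G₂(ℂ))`). -/
def amat (x : ℝ) : Matrix (Fin 8) (Fin 8) ℂ :=
  Matrix.of fun i j =>
    (![ e 0,
        e 1,
        (Real.cosh x : ℂ) • e 2 + (Complex.I * (Real.sinh x : ℂ)) • e 3,
        (-(Complex.I * (Real.sinh x : ℂ))) • e 2 + (Real.cosh x : ℂ) • e 3,
        (Real.cosh x : ℂ) • e 4 + (Complex.I * (Real.sinh x : ℂ)) • e 5,
        (-(Complex.I * (Real.sinh x : ℂ))) • e 4 + (Real.cosh x : ℂ) • e 5,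
        (Real.cosh x : ℂ) • e 6 + (Complex.I * (Real.sinh x : ℂ)) • e 7,
        (-(Complex.I * (Real.sinh x : ℂ))) • e 6 + (Real.cosh x : ℂ) • e 7 ] j) i

/-- The matrix `I₊₋ = diag(1, −1, 1, −1, 1, −1, 1, −1)`. -/
def Ipm : Matrix (Fin 8) (Fin 8) ℂ :=
  Matrix.diagonal ![1, -1, 1, -1, 1, -1, 1, -1]

/-- The anti-holomorphic involution `σ₀(g) = I₊₋ ḡ I₊₋`. -/
def sigma0 (g : Matrix (Fin 8) (Fin 8) ℂ) : Matrix (Fin 8) (Fin 8) ℂ :=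
  Ipm * g.map (starRingEnd ℂ) * Ipm

end

set_option maxHeartbeats 1000000 in
theorem octMul_eq (x y : Fin 8 → ℂ) : octMul x y =
    ![x 0 * y 0 - x 1 * y 1 - x 2 * y 2 - x 3 * y 3 - x 4 * y 4 - x 5 * y 5 - x 6 * y 6 - x 7 * y 7,
      x 0 * y 1 + x 1 * y 0 + x 2 * y 3 - x 3 * y 2 + x 4 * y 5 - x 5 * y 4 + x 6 * y 7 - x 7 * y 6,
      x 0 * y 2 - x 1 * y 3 + x 2 * y 0 + x 3 * y 1 - x 4 * y 6 + x 5 * y 7 + x 6 * y 4 - x 7 * y 5,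
      x 0 * y 3 + x 1 * y 2 - x 2 * y 1 + x 3 * y 0 + x 4 * y 7 + x 5 * y 6 - x 6 * y 5 - x 7 * y 4,
      x 0 * y 4 - x 1 * y 5 + x 2 * y 6 - x 3 * y 7 + x 4 * y 0 + x 5 * y 1 - x 6 * y 2 + x 7 * y 3,
      x 0 * y 5 + x 1 * y 4 - x 2 * y 7 - x 3 * y 6 - x 4 * y 1 + x 5 * y 0 + x 6 * y 3 + x 7 * y 2,
      x 0 * y 6 - x 1 * y 7 - x 2 * y 4 + x 3 * y 5 + x 4 * y 2 - x 5 * y 3 + x 6 * y 0 + x 7 * y 1,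
      x 0 * y 7 + x 1 * y 6 + x 2 * y 5 + x 3 * y 4 - x 4 * y 3 - x 5 * y 2 - x 6 * y 1 + x 7 * y 0] := by
  ext k
  fin_cases k <;>
    simp [octMul, Fin.sum_univ_eight, octBasisMul, octLines, e] <;> ring

/-- The matrix of left multiplication by `u`. -/
def lmul (u : Fin 8 → ℂ) : Matrix (Fin 8) (Fin 8) ℂ :=
  Matrix.of fun i j => octMul u (e j) i

theorem lmul_mulVec (u x : Fin 8 → ℂ) : lmul u *ᵥ x = octMul u x := by
  ext k
  fin_cases k <;>
    simp [lmul, octMul_eq, Matrix.mulVec, dotProduct, Fin.sum_univ_eight, e] <;> ring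

set_option maxHeartbeats 1000000 in
theorem lmul_transpose {u : Fin 8 → ℂ} (hu : u 0 = 0) : (lmul u)ᵀ = -lmul u := by
  ext i j
  fin_cases i <;> fin_cases j <;> simp [lmul, octMul_eq, e, hu]

theorem octMul_clifford {x : Fin 8 → ℂ} (hx : x 0 = 0) (y z : Fin 8 → ℂ) :
    octMul x (octMul y z) + octMul y (octMul x z) =
      (2 * y 0) • octMul x z - (2 * (x ⬝ᵥ y)) • z := by
  ext k
  fin_cases k <;>
    simp [octMul_eq, dotProduct, Fin.sum_univ_eight, hx] <;> ring

theorem octMul_octMul_self_right (x : Fin 8 → ℂ) {y : Fin 8 → ℂ} (hy : y 0 = 0) :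
    octMul (octMul x y) y = -(y ⬝ᵥ y) • x := by
  ext k
  fin_cases k <;>
    simp [octMul_eq, dotProduct, Fin.sum_univ_eight, hy] <;> ring

theorem octMul_dotProduct_self (x y : Fin 8 → ℂ) :
    octMul x y ⬝ᵥ octMul x y = (x ⬝ᵥ x) * (y ⬝ᵥ y) := by
  simp [octMul_eq, dotProduct, Fin.sum_univ_eight]
  ring

theorem octMul_e_zero_left (x : Fin 8 → ℂ) : octMul (e 0) x = x := by
  ext k
  fin_cases k <;> simp [octMul_eq, e]

theorem octMul_e_zero_right (x : Fin 8 → ℂ) : octMul x (e 0) = x := by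
  ext k
  fin_cases k <;> simp [octMul_eq, e]

theorem octMul_add_left (x y z : Fin 8 → ℂ) :
    octMul (x + y) z = octMul x z + octMul y z := by
  simp [octMul, add_mul, add_smul, Finset.sum_add_distrib]

theorem octMul_smul_left (c : ℂ) (x z : Fin 8 → ℂ) : octMul (c • x) z = c • octMul x z := by
  simp [octMul, Finset.smul_sum, smul_smul, mul_assoc]

theorem octMul_neg_left (x z : Fin 8 → ℂ) : octMul (-x) z = -octMul x z := by
  simpa using octMul_smul_left (-1) x z

theorem octMul_neg_right (x z : Fin 8 → ℂ) : octMul x (-z) = -octMul x z := by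
  simp only [← lmul_mulVec, mulVec_neg]

theorem octMul_octMul_self_left {x : Fin 8 → ℂ} (hx : x 0 = 0) (z : Fin 8 → ℂ) :
    octMul x (octMul x z) = -(x ⬝ᵥ x) • z := by
  have h := octMul_clifford hx x z
  rw [hx, mul_zero, zero_smul, zero_sub, ← two_smul ℂ, mul_smul, ← smul_neg] at h
  rw [neg_smul]
  exact smul_right_injective _ (two_ne_zero (α := ℂ)) h

theorem octMul_anticomm {x y : Fin 8 → ℂ} (hx : x 0 = 0) (hy : y 0 = 0) (hxy : x ⬝ᵥ y = 0)
    (z : Fin 8 → ℂ) : octMul x (octMul y z) = -octMul y (octMul x z) := by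
  have h := octMul_clifford hx y z
  rw [hy, hxy, mul_zero, zero_smul, zero_smul, sub_zero] at h
  exact eq_neg_of_add_eq_zero_left h

theorem octMul_comm_neg {x y : Fin 8 → ℂ} (hx : x 0 = 0) (hy : y 0 = 0) (hxy : x ⬝ᵥ y = 0) :
    octMul x y = -octMul y x := by
  simpa only [octMul_e_zero_right] using octMul_anticomm hx hy hxy (e 0)

theorem octMul_dotProduct {u : Fin 8 → ℂ} (hu : u 0 = 0) (v w : Fin 8 → ℂ) :
    octMul u v ⬝ᵥ w = -(v ⬝ᵥ octMul u w) := by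
  rw [← lmul_mulVec, ← lmul_mulVec, ← vecMul_transpose, lmul_transpose hu, ← dotProduct_mulVec,
    neg_mulVec, dotProduct_neg]

theorem lmul_mul_self {u : Fin 8 → ℂ} (hu : u 0 = 0) (huu : u ⬝ᵥ u = 1) :
    lmul u * lmul u = -1 := by
  apply Matrix.mulVec_injective
  funext x
  rw [← mulVec_mulVec, lmul_mulVec, lmul_mulVec, octMul_octMul_self_left hu, huu, neg_mulVec,
    one_mulVec, neg_one_smul]

theorem SO8.mul {g h : Matrix (Fin 8) (Fin 8) ℂ} (hg : SO8 g) (hh : SO8 h) : SO8 (g * h) := by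
  refine ⟨?_, by rw [det_mul, hg.2, hh.2, mul_one]⟩
  rw [transpose_mul, Matrix.mul_assoc, ← Matrix.mul_assoc gᵀ, hg.1, Matrix.one_mul, hh.1]

theorem SO8.mul_transpose {g : Matrix (Fin 8) (Fin 8) ℂ} (hg : SO8 g) : g * gᵀ = 1 :=
  mul_eq_one_comm.mp hg.1

theorem SO8.transpose {g : Matrix (Fin 8) (Fin 8) ℂ} (hg : SO8 g) : SO8 gᵀ :=
  ⟨by rw [transpose_transpose, hg.mul_transpose], by rw [det_transpose, hg.2]⟩

theorem SO8.transpose_mulVec_mulVec {g : Matrix (Fin 8) (Fin 8) ℂ} (hg : SO8 g)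
    (x : Fin 8 → ℂ) : gᵀ *ᵥ g *ᵥ x = x := by
  rw [mulVec_mulVec, hg.1, one_mulVec]

theorem SO8.mulVec_transpose_mulVec {g : Matrix (Fin 8) (Fin 8) ℂ} (hg : SO8 g)
    (x : Fin 8 → ℂ) : g *ᵥ gᵀ *ᵥ x = x := by
  rw [mulVec_mulVec, hg.mul_transpose, one_mulVec]

theorem SO8.mulVec_dotProduct_mulVec {g : Matrix (Fin 8) (Fin 8) ℂ} (hg : SO8 g)
    (x y : Fin 8 → ℂ) : g *ᵥ x ⬝ᵥ g *ᵥ y = x ⬝ᵥ y := by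
  rw [dotProduct_mulVec, vecMul_mulVec, ← dotProduct_mulVec, hg.1, one_mulVec]

theorem inB3.mul {g h : Matrix (Fin 8) (Fin 8) ℂ} (hg : inB3 g) (hh : inB3 h) :
    inB3 (g * h) := by
  obtain ⟨hg, g₀, hg₀, hg1, hgm⟩ := hg
  obtain ⟨hh, h₀, hh₀, hh1, hhm⟩ := hh
  refine ⟨hg.mul hh, g₀ * h₀, hg₀.mul hh₀, by rw [← mulVec_mulVec, hh1, hg1], fun x y => ?_⟩
  simp only [← mulVec_mulVec]
  rw [hgm, hhm]

theorem inB3.transpose {g : Matrix (Fin 8) (Fin 8) ℂ} (hg : inB3 g) : inB3 gᵀ := by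
  obtain ⟨hg, g₀, hg₀, hg1, hgm⟩ := hg
  refine ⟨hg.transpose, g₀ᵀ, hg₀.transpose, ?_, fun x y => ?_⟩
  · conv_lhs => rw [← hg1]
    exact hg₀.transpose_mulVec_mulVec _
  · rw [← hg.transpose_mulVec_mulVec (octMul _ _), ← hgm, hg₀.mulVec_transpose_mulVec,
      hg.mulVec_transpose_mulVec]

theorem inB3.inG2 {g : Matrix (Fin 8) (Fin 8) ℂ} (hg : inB3 g) (h1 : g *ᵥ e 0 = e 0) :
    inG2 g := by
  obtain ⟨hg, g₀, hg₀, hg1, hgm⟩ := hg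
  have h : ∀ x, g₀ *ᵥ x = g *ᵥ x := fun x => by
    have := hgm x (e 0)
    rwa [h1, octMul_e_zero_right, octMul_e_zero_right] at this
  exact ⟨hg, fun x y => by rw [← hgm, h]⟩

/-- A vector of `ℂ^8` has real entries. -/
def RealVec (v : Fin 8 → ℂ) : Prop := ∀ i, (v i).im = 0

theorem realMat.mul {g h : Matrix (Fin 8) (Fin 8) ℂ} (hg : realMat g) (hh : realMat h) :
    realMat (g * h) := fun i j => by
  simp [Matrix.mul_apply, hg _ _, hh _ _]

theorem realMat.mulVec {g : Matrix (Fin 8) (Fin 8) ℂ} (hg : realMat g) {v : Fin 8 → ℂ}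
    (hv : RealVec v) : RealVec (g *ᵥ v) := fun i => by
  simp [Matrix.mulVec, dotProduct, hg _ _, hv _]

theorem realVec_e (i : Fin 8) : RealVec (e i) := fun j => by
  by_cases h : j = i <;> simp [e, h]

theorem RealVec.add {v w : Fin 8 → ℂ} (hv : RealVec v) (hw : RealVec w) : RealVec (v + w) :=
  fun i => by simp [hv i, hw i]

theorem RealVec.neg {v : Fin 8 → ℂ} (hv : RealVec v) : RealVec (-v) :=
  fun i => by simp [hv i]

theorem RealVec.sub {v w : Fin 8 → ℂ} (hv : RealVec v) (hw : RealVec w) : RealVec (v - w) :=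
  fun i => by simp [hv i, hw i]

theorem RealVec.octMul {v w : Fin 8 → ℂ} (hv : RealVec v) (hw : RealVec w) :
    RealVec (octMul v w) := fun i => by
  fin_cases i <;> simp [octMul_eq, hv _, hw _]

theorem inSpin7.mul {g h : Matrix (Fin 8) (Fin 8) ℂ} (hg : inSpin7 g) (hh : inSpin7 h) :
    inSpin7 (g * h) := by
  obtain ⟨hg, hgr, g₀, hg₀, hgr₀, hg1, hgm⟩ := hg
  obtain ⟨hh, hhr, h₀, hh₀, hhr₀, hh1, hhm⟩ := hh
  refine ⟨hg.mul hh, hgr.mul hhr, g₀ * h₀, hg₀.mul hh₀, hgr₀.mul hhr₀,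
    by rw [← mulVec_mulVec, hh1, hg1], fun x y => ?_⟩
  simp only [← mulVec_mulVec]
  rw [hgm, hhm]

theorem inSpin7.inB3 {g : Matrix (Fin 8) (Fin 8) ℂ} (hg : inSpin7 g) : inB3 g :=
  let ⟨hg, _, g₀, hg₀, _, h⟩ := hg
  ⟨hg, g₀, hg₀, h⟩

/-- The reflection in the hyperplane orthogonal to a unit vector `v`. -/
def hyperplaneReflection (v : Fin 8 → ℂ) : Matrix (Fin 8) (Fin 8) ℂ :=
  1 - (2 : ℂ) • vecMulVec v v

theorem hyperplaneReflection_mulVec (v x : Fin 8 → ℂ) :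
    hyperplaneReflection v *ᵥ x = x - (2 * (v ⬝ᵥ x)) • v := by
  rw [hyperplaneReflection, sub_mulVec, one_mulVec, smul_mulVec, vecMulVec_mulVec, op_smul_eq_smul,
    smul_smul]

theorem hyperplaneReflection_transpose (v : Fin 8 → ℂ) :
    (hyperplaneReflection v)ᵀ = hyperplaneReflection v := by
  simp [hyperplaneReflection, transpose_sub, transpose_vecMulVec]

theorem hyperplaneReflection_mul_self {v : Fin 8 → ℂ} (hv : v ⬝ᵥ v = 1) :
    hyperplaneReflection v * hyperplaneReflection v = 1 := by
  apply Matrix.mulVec_injective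
  funext x
  rw [← mulVec_mulVec, hyperplaneReflection_mulVec, hyperplaneReflection_mulVec, dotProduct_sub,
    dotProduct_smul, hv, one_mulVec]
  module

theorem hyperplaneReflection_det {v : Fin 8 → ℂ} (hv : v ⬝ᵥ v = 1) :
    (hyperplaneReflection v).det = -1 := by
  have : hyperplaneReflection v
      = 1 + replicateCol Unit ((-2 : ℂ) • v) * replicateRow Unit v := by
    rw [← vecMulVec_eq, smul_vecMulVec, hyperplaneReflection, neg_smul, sub_eq_add_neg]
  rw [this, det_one_add_replicateCol_mul_replicateRow, dotProduct_smul, hv]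
  norm_num

theorem realMat_hyperplaneReflection {v : Fin 8 → ℂ} (hv : RealVec v) :
    realMat (hyperplaneReflection v) := fun i j => by
  by_cases h : i = j <;>
    simp [hyperplaneReflection, vecMulVec_apply, h, hv _]

theorem e_zero_dotProduct (x : Fin 8 → ℂ) : e 0 ⬝ᵥ x = x 0 := by
  simp [e]

theorem lmul_SO8 {u : Fin 8 → ℂ} (hu : u 0 = 0) (huu : u ⬝ᵥ u = 1) : SO8 (lmul u) := by
  have hsq := lmul_mul_self hu huu
  refine ⟨by rw [lmul_transpose hu, neg_mul, hsq, neg_neg], ?_⟩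
  obtain ⟨c, hc⟩ := IsAlgClosed.exists_pow_nat_eq (1 / 2 : ℂ) (n := 2) two_pos
  -- `c • (1 + lmul u)` is an orthogonal square root of `lmul u`.
  have h1 : (c • (1 + lmul u)) * (c • (1 + lmul u)) = lmul u := by
    rw [smul_mul_smul_comm, ← sq, hc, add_mul, mul_add, mul_add, hsq, Matrix.one_mul,
      Matrix.mul_one, Matrix.one_mul]
    module
  have h2 : (c • (1 + lmul u))ᵀ * (c • (1 + lmul u)) = 1 := by
    rw [transpose_smul, transpose_add, transpose_one, lmul_transpose hu, smul_mul_smul_comm, ← sq,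
      hc, add_mul, mul_add, mul_add, neg_mul, neg_mul, hsq, Matrix.one_mul,
      Matrix.mul_one, Matrix.one_mul]
    module
  rw [← h1, det_mul]
  nth_rw 1 [← det_transpose]
  rw [← det_mul, h2, det_one]

theorem lmul_companion {u : Fin 8 → ℂ} (hu : u 0 = 0) (huu : u ⬝ᵥ u = 1) :
    let g₀ := -(hyperplaneReflection (e 0) * hyperplaneReflection u)
    SO8 g₀ ∧ g₀ *ᵥ e 0 = e 0 ∧
      ∀ x y, octMul (g₀ *ᵥ x) (lmul u *ᵥ y) = lmul u *ᵥ octMul x y := by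
  have he : e 0 ⬝ᵥ e 0 = 1 := by simp [e]
  have hx : ∀ x, -(hyperplaneReflection (e 0) * hyperplaneReflection u) *ᵥ x =
      (-1 : ℂ) • x + ((2 * (u ⬝ᵥ x)) • u + (2 * x 0) • e 0) := fun x => by
    rw [neg_mulVec, ← mulVec_mulVec, hyperplaneReflection_mulVec, hyperplaneReflection_mulVec,
      e_zero_dotProduct, Pi.sub_apply, Pi.smul_apply, hu]
    module
  refine ⟨⟨?_, ?_⟩, ?_, fun x y => ?_⟩
  · rw [transpose_neg, neg_mul_neg, transpose_mul, hyperplaneReflection_transpose,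
      hyperplaneReflection_transpose, Matrix.mul_assoc,
      ← Matrix.mul_assoc (hyperplaneReflection (e 0)), hyperplaneReflection_mul_self he,
      Matrix.one_mul, hyperplaneReflection_mul_self huu]
  · rw [det_neg, det_mul, hyperplaneReflection_det he, hyperplaneReflection_det huu]
    norm_num
  · have h0 : (e 0 : Fin 8 → ℂ) 0 = 1 := by simp [e]
    rw [hx, dotProduct_comm, e_zero_dotProduct, hu, h0]
    module
  · have h := octMul_clifford hu x y
    rw [← eq_sub_iff_add_eq] at h
    rw [hx, lmul_mulVec, lmul_mulVec, octMul_add_left, octMul_add_left, octMul_smul_left,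
      octMul_smul_left, octMul_smul_left, octMul_e_zero_left, octMul_octMul_self_left hu, huu, h]
    module

theorem lmul_inB3 {u : Fin 8 → ℂ} (hu : u 0 = 0) (huu : u ⬝ᵥ u = 1) : inB3 (lmul u) :=
  ⟨lmul_SO8 hu huu, _, lmul_companion hu huu⟩

theorem lmul_inSpin7 {u : Fin 8 → ℂ} (hr : RealVec u) (hu : u 0 = 0) (huu : u ⬝ᵥ u = 1) :
    inSpin7 (lmul u) := by
  obtain ⟨h₀, h1, hm⟩ := lmul_companion hu huu
  refine ⟨lmul_SO8 hu huu, fun i j => hr.octMul (realVec_e j) i, _, h₀, fun i j => ?_, h1, hm⟩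
  rw [Matrix.neg_apply, Complex.neg_im, neg_eq_zero]
  exact (realMat_hyperplaneReflection (realVec_e 0)).mul (realMat_hyperplaneReflection hr) i j

theorem RealVec.exists_eq_smul_unit {v : Fin 8 → ℂ} (hv : RealVec v) (h0 : v ≠ 0) :
    ∃ (s : ℝ) (w : Fin 8 → ℂ), 0 < s ∧ RealVec w ∧ w ⬝ᵥ w = 1 ∧ v = (s : ℂ) • w := by
  have hre : ∀ i, v i = ((v i).re : ℂ) := fun i => Complex.ext rfl (by simp [hv i])
  have hdot : v ⬝ᵥ v = ((∑ i, (v i).re ^ 2 : ℝ) : ℂ) := by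
    push_cast
    exact Finset.sum_congr rfl fun i _ => by rw [← hre, sq]
  have hpos : 0 < ∑ i, (v i).re ^ 2 := by
    refine lt_of_le_of_ne (Finset.sum_nonneg fun i _ => sq_nonneg _) fun h => h0 ?_
    ext i
    have := (Finset.sum_eq_zero_iff_of_nonneg fun i _ => sq_nonneg _).mp h.symm i
      (Finset.mem_univ i)
    rw [hre, pow_eq_zero_iff two_ne_zero |>.mp this]
    rfl
  set S := ∑ i, (v i).re ^ 2
  have hs : (Real.sqrt S : ℂ) ≠ 0 := by exact_mod_cast (Real.sqrt_pos.mpr hpos).ne'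
  have hss : (Real.sqrt S : ℂ) * Real.sqrt S = S := by
    exact_mod_cast Real.mul_self_sqrt hpos.le
  refine ⟨Real.sqrt S, (Real.sqrt S : ℂ)⁻¹ • v, Real.sqrt_pos.mpr hpos, fun i => ?_, ?_, ?_⟩
  · rw [Pi.smul_apply, smul_eq_mul, ← Complex.ofReal_inv, Complex.im_ofReal_mul, hv i, mul_zero]
  · rw [smul_dotProduct, dotProduct_smul, hdot, ← hss, smul_eq_mul, smul_eq_mul]
    field_simp
  · rw [smul_smul, mul_inv_cancel₀ hs, one_smul]

theorem exists_unit_orthogonal {n : ℕ} (hn : n < 8) (A : Fin n → Fin 8 → ℂ)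
    (hA : ∀ i, RealVec (A i)) :
    ∃ w : Fin 8 → ℂ, RealVec w ∧ w ⬝ᵥ w = 1 ∧ ∀ i, A i ⬝ᵥ w = 0 := by
  let f : (Fin 8 → ℝ) →ₗ[ℝ] (Fin n → ℝ) :=
    Matrix.mulVecLin (Matrix.of fun i j => (A i j).re)
  have hf : LinearMap.ker f ≠ ⊥ := LinearMap.ker_ne_bot_of_finrank_lt (by simpa using hn)
  obtain ⟨r, hr, hr0⟩ := Submodule.exists_mem_ne_zero_of_ne_bot hf
  have hAr : ∀ i, A i ⬝ᵥ (fun j => (r j : ℂ)) = 0 := fun i => by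
    have h := congrArg (fun t : ℝ => (t : ℂ)) (congrFun (LinearMap.mem_ker.mp hr) i)
    simp only [f, Matrix.mulVecLin_apply, Matrix.mulVec, dotProduct, Matrix.of_apply,
      Pi.zero_apply] at h
    push_cast at h
    rw [← h]
    refine Finset.sum_congr rfl fun j _ => ?_
    rw [show A i j = ((A i j).re : ℂ) from Complex.ext rfl (by simp [hA i j])]
    simp
  have hrr : RealVec fun j => (r j : ℂ) := fun j => Complex.ofReal_im _
  obtain ⟨s, w, hs, hw, hww, hrw⟩ := hrr.exists_eq_smul_unit fun h => hr0 <| by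
    ext j
    exact Complex.ofReal_eq_zero.mp (congrFun h j)
  refine ⟨w, hw, hww, fun i => ?_⟩
  have h := hAr i
  rw [hrw, dotProduct_smul, smul_eq_mul, mul_eq_zero] at h
  exact h.resolve_left (by exact_mod_cast hs.ne')

/-- `Spin(7)` acts transitively on the unit sphere of `ℝ^8`. -/
theorem exists_inSpin7_mulVec_e_zero {a : Fin 8 → ℂ} (ha : RealVec a) (haa : a ⬝ᵥ a = 1) :
    ∃ k, inSpin7 k ∧ k *ᵥ e 0 = a := by
  obtain ⟨w, hw, hww, hA⟩ := exists_unit_orthogonal (by norm_num) ![e 0, a]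
    (by simpa [Fin.forall_fin_two] using ⟨realVec_e 0, ha⟩)
  have hw0 : w 0 = 0 := (e_zero_dotProduct _).symm.trans (hA 0)
  have haw : a ⬝ᵥ w = 0 := hA 1
  have hu0 : (-octMul a w) 0 = 0 := by
    have : (octMul a w) 0 = 2 * (a 0 * w 0) - a ⬝ᵥ w := by
      simp [octMul_eq, dotProduct, Fin.sum_univ_eight]
      ring
    rw [Pi.neg_apply, this, haw, hw0]
    simp
  have huu : -octMul a w ⬝ᵥ -octMul a w = 1 := by
    rw [neg_dotProduct_neg, octMul_dotProduct_self, haa, hww, mul_one]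
  refine ⟨lmul (-octMul a w) * lmul w,
    (lmul_inSpin7 (ha.octMul hw).neg hu0 huu).mul (lmul_inSpin7 hw hw0 hww), ?_⟩
  rw [← mulVec_mulVec, lmul_mulVec, lmul_mulVec, octMul_e_zero_right, octMul_neg_left,
    octMul_octMul_self_right a hw0, hww, neg_smul, one_smul, neg_neg]

/-- The involution of `𝕆` that fixes the quaternion subalgebra generated by two orthonormal
imaginary octonions `y`, `z` and is `-1` on its orthogonal complement. -/
theorem exists_inSpin7_fix_neg {y z : Fin 8 → ℂ} (hy : RealVec y) (hz : RealVec z)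
    (hy0 : y 0 = 0) (hz0 : z 0 = 0) (hyy : y ⬝ᵥ y = 1) (hzz : z ⬝ᵥ z = 1) (hyz : y ⬝ᵥ z = 0) :
    ∃ k, inSpin7 k ∧ k *ᵥ e 0 = e 0 ∧ k *ᵥ y = y ∧
      ∀ q : Fin 8 → ℂ, q 0 = 0 → y ⬝ᵥ q = 0 → z ⬝ᵥ q = 0 → octMul y q ⬝ᵥ z = 0 →
        k *ᵥ q = -q := by
  have hx0 : (octMul y z) 0 = 0 := by
    rw [← e_zero_dotProduct (octMul y z), dotProduct_comm, octMul_dotProduct hy0,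
      octMul_e_zero_right, dotProduct_comm, hyz, neg_zero]
  have hxx : octMul y z ⬝ᵥ octMul y z = 1 := by rw [octMul_dotProduct_self, hyy, hzz, mul_one]
  refine ⟨lmul (-octMul y z) * (lmul y * lmul z),
    (lmul_inSpin7 (hy.octMul hz).neg (by rw [Pi.neg_apply, hx0, neg_zero])
      (by rw [neg_dotProduct_neg, hxx])).mul
      ((lmul_inSpin7 hy hy0 hyy).mul (lmul_inSpin7 hz hz0 hzz)), ?_, ?_, fun q hq0 hyq hzq hq => ?_⟩
  all_goals simp only [← mulVec_mulVec, lmul_mulVec, octMul_neg_left]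
  · have h := octMul_octMul_self_left hx0 (e 0)
    rw [octMul_e_zero_right, hxx, neg_smul, one_smul] at h
    rw [octMul_e_zero_right, h, neg_neg]
  · rw [octMul_comm_neg hz0 hy0 (by rwa [dotProduct_comm]), octMul_neg_right,
      octMul_octMul_self_left hy0, hyy, neg_smul, one_smul, neg_neg,
      octMul_octMul_self_right y hz0, hzz, neg_smul, one_smul, neg_neg]
  · have hxq : octMul y z ⬝ᵥ q = 0 := by
      rw [octMul_dotProduct hy0, dotProduct_comm, hq, neg_zero]
    rw [octMul_comm_neg hz0 hq0 hzq, octMul_neg_right, octMul_anticomm hy0 hq0 hyq,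
      neg_neg, octMul_comm_neg hq0 hx0 (by rwa [dotProduct_comm]), octMul_neg_right,
      octMul_octMul_self_left hx0, hxx, neg_smul, one_smul, neg_neg]

/-- `G₂` acts transitively on the unit sphere of the imaginary octonions. -/
theorem exists_inSpin7_mulVec_e_one {c : Fin 8 → ℂ} (hc : RealVec c) (hc0 : c 0 = 0)
    (hcc : c ⬝ᵥ c = 1) : ∃ k, inSpin7 k ∧ k *ᵥ e 0 = e 0 ∧ k *ᵥ e 1 = c := by
  have he0 : (e 1 : Fin 8 → ℂ) 0 = 0 := by simp [e]
  have hee : (e 1 : Fin 8 → ℂ) ⬝ᵥ e 1 = 1 := by simp [e]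
  obtain ⟨y, s, hy, hyy, hy0, hs, hyq⟩ : ∃ (y : Fin 8 → ℂ) (s : ℂ), RealVec y ∧ y ⬝ᵥ y = 1 ∧
      y 0 = 0 ∧ e 1 + c = s • y ∧ y ⬝ᵥ (e 1 - c) = 0 := by
    by_cases h : e 1 + c = 0
    · obtain ⟨y, hy, hyy, hA⟩ := exists_unit_orthogonal (by norm_num) ![e 0, e 1 - c]
        (by simpa [Fin.forall_fin_two] using ⟨realVec_e 0, (realVec_e 1).sub hc⟩)
      exact ⟨y, 0, hy, hyy, (e_zero_dotProduct _).symm.trans (hA 0), by rw [h, zero_smul],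
        by rw [dotProduct_comm]; exact hA 1⟩
    · obtain ⟨s, y, hs, hy, hyy, hsy⟩ := ((realVec_e 1).add hc).exists_eq_smul_unit h
      have hs' : (s : ℂ) ≠ 0 := by exact_mod_cast hs.ne'
      refine ⟨y, s, hy, hyy, ?_, hsy, ?_⟩
      · have h0 := congrFun hsy 0
        rw [Pi.add_apply, he0, hc0, add_zero, Pi.smul_apply, smul_eq_mul] at h0
        exact (mul_eq_zero.mp h0.symm).resolve_left hs'
      · have h0 : (e 1 + c) ⬝ᵥ (e 1 - c) = 0 := by
          rw [add_dotProduct, dotProduct_sub, dotProduct_sub, hee, hcc, dotProduct_comm c]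
          ring
        rw [hsy, smul_dotProduct, smul_eq_mul] at h0
        exact (mul_eq_zero.mp h0).resolve_left hs'
  have hq : RealVec (e 1 - c) := (realVec_e 1).sub hc
  obtain ⟨z, hz, hzz, hA⟩ := exists_unit_orthogonal (by norm_num)
    ![e 0, y, e 1 - c, octMul y (e 1 - c)] (by
      intro i
      fin_cases i
      exacts [realVec_e 0, hy, hq, hy.octMul hq])
  obtain ⟨k, hk, hk0, hky, hkq⟩ := exists_inSpin7_fix_neg hy hz hy0
    ((e_zero_dotProduct _).symm.trans (hA 0)) hyy hzz (hA 1)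
  have h1 : k *ᵥ (e 1 + c) = e 1 + c := by rw [hs, mulVec_smul, hky]
  have h2 : k *ᵥ (e 1 - c) = -(e 1 - c) := hkq _ (by rw [Pi.sub_apply, he0, hc0, sub_zero]) hyq
    (by rw [dotProduct_comm]; exact hA 2) (hA 3)
  refine ⟨k, hk, hk0, smul_right_injective _ (two_ne_zero (α := ℂ)) ?_⟩
  change (2 : ℂ) • k *ᵥ e 1 = (2 : ℂ) • c
  rw [← mulVec_smul, show (2 : ℂ) • e 1 = (e 1 + c) + (e 1 - c) by module, mulVec_add, h1, h2]
  module

/-- The element `cos t + sin t · e_i e_j` of the Clifford algebra lies in `Spin(7, ℂ)`; here `C`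
and `P` play the roles of `cos t` and `sin t`. -/
theorem lmul_mul_lmul_inB3 {i j : Fin 8} (hi : i ≠ 0) (hj : j ≠ 0) (hij : i ≠ j) {C P : ℂ}
    (h : C ^ 2 + P ^ 2 = 1) : inB3 (lmul (e i) * lmul (-C • e i + P • e j)) := by
  refine (lmul_inB3 ?_ ?_).mul (lmul_inB3 ?_ ?_)
  · simp [e, hi.symm]
  · simp [e]
  · simp [e, hi.symm, hj.symm]
  · simp [e, hij, hij.symm]
    linear_combination h

theorem cosh_sq_add_I_sinh_sq (t : ℝ) :
    (Real.cosh t : ℂ) ^ 2 + (Complex.I * (Real.sinh t : ℂ)) ^ 2 = 1 := by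
  rw [mul_pow, Complex.I_sq, neg_one_mul, ← sub_eq_add_neg]
  exact_mod_cast Real.cosh_sq_sub_sinh_sq t

theorem atil_eq_prod (θ : ℝ) :
    atil θ =
      (lmul (e 2) * lmul (-(Real.cosh (θ / 3) : ℂ) • e 2
          + (Complex.I * Real.sinh (θ / 3)) • e 3)) *
      ((lmul (e 4) * lmul (-(Real.cosh (θ / 3) : ℂ) • e 4
          + (Complex.I * Real.sinh (θ / 3)) • e 5)) *
      (lmul (e 6) * lmul (-(Real.cosh (θ / 3) : ℂ) • e 6
          + (Complex.I * Real.sinh (θ / 3)) • e 7))) := by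
  have hC : (Real.cosh θ : ℂ) = 4 * Real.cosh (θ / 3) ^ 3 - 3 * Real.cosh (θ / 3) := by
    have := Real.cosh_three_mul (θ / 3)
    rw [mul_div_cancel₀ θ (three_ne_zero)] at this
    exact_mod_cast this
  have hS : Complex.I * (Real.sinh θ : ℂ)
      = 3 * (Complex.I * Real.sinh (θ / 3)) - 4 * (Complex.I * Real.sinh (θ / 3)) ^ 3 := by
    have := Real.sinh_three_mul (θ / 3)
    rw [mul_div_cancel₀ θ (three_ne_zero)] at this
    rw [this, mul_pow, Complex.I_pow_three]
    push_cast
    ring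
  have hCS := cosh_sq_add_I_sinh_sq (θ / 3)
  apply Matrix.mulVec_injective
  funext x
  simp only [← mulVec_mulVec, lmul_mulVec, atil, hC, hS]
  generalize (Real.cosh (θ / 3) : ℂ) = C at *
  generalize Complex.I * (Real.sinh (θ / 3) : ℂ) = P at *
  ext k
  fin_cases k <;>
    simp [octMul_eq, Matrix.mulVec, dotProduct, Fin.sum_univ_eight, e]
  · linear_combination (3 * C * x 0 + 3 * P * x 1) * hCS
  · linear_combination (-3 * P * x 0 + 3 * C * x 1) * hCS
  · linear_combination (-C * x 2 - P * x 3) * hCS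
  · linear_combination (P * x 2 - C * x 3) * hCS
  · linear_combination (-C * x 4 - P * x 5) * hCS
  · linear_combination (P * x 4 - C * x 5) * hCS
  · linear_combination (-C * x 6 - P * x 7) * hCS
  · linear_combination (P * x 6 - C * x 7) * hCS

theorem atil_inB3 (θ : ℝ) : inB3 (atil θ) := by
  rw [atil_eq_prod]
  have h := cosh_sq_add_I_sinh_sq (θ / 3)
  exact (lmul_mul_lmul_inB3 (by decide) (by decide) (by decide) h).mul
    ((lmul_mul_lmul_inB3 (by decide) (by decide) (by decide) h).mul
      (lmul_mul_lmul_inB3 (by decide) (by decide) (by decide) h))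

theorem atil_mulVec_e_zero (θ : ℝ) :
    atil θ *ᵥ e 0 = (Real.cosh θ : ℂ) • e 0 + (Complex.I * (Real.sinh θ : ℂ)) • e 1 := by
  rw [e, mulVec_single_one]
  rfl

/-- `Spin(7)` acts transitively on orthonormal pairs of vectors of `ℝ^8`. -/
theorem exists_inSpin7_mulVec_pair {a b : Fin 8 → ℂ} (ha : RealVec a) (hb : RealVec b)
    (haa : a ⬝ᵥ a = 1) (hbb : b ⬝ᵥ b = 1) (hab : a ⬝ᵥ b = 0) :
    ∃ k, inSpin7 k ∧ k *ᵥ e 0 = a ∧ k *ᵥ e 1 = b := by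
  obtain ⟨k, hk, hka⟩ := exists_inSpin7_mulVec_e_zero ha haa
  obtain ⟨l, hl, hl0, hl1⟩ := exists_inSpin7_mulVec_e_one (c := kᵀ *ᵥ b)
    (realMat.mulVec (fun i j => hk.2.1 j i) hb)
    (by rw [← e_zero_dotProduct (kᵀ *ᵥ b), ← hk.1.mulVec_dotProduct_mulVec, hk.1.mulVec_transpose_mulVec,
      hka, hab])
    (by rw [hk.1.transpose.mulVec_dotProduct_mulVec, hbb])
  exact ⟨k * l, hk.mul hl, by rw [← mulVec_mulVec, hl0, hka],
    by rw [← mulVec_mulVec, hl1, hk.1.mulVec_transpose_mulVec]⟩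

/-- `Spin(7) · Ã₀` moves `e₀` to every point of the complex unit sphere. -/
theorem exists_inSpin7_atil_mulVec_e_zero {v : Fin 8 → ℂ} (hv : v ⬝ᵥ v = 1) :
    ∃ k θ, inSpin7 k ∧ (k * atil θ) *ᵥ e 0 = v := by
  set a : Fin 8 → ℂ := fun i => ((v i).re : ℂ) with ha_def
  set b : Fin 8 → ℂ := fun i => ((v i).im : ℂ) with hb_def
  have ha : RealVec a := fun i => Complex.ofReal_im _
  have hb : RealVec b := fun i => Complex.ofReal_im _
  have hab : v = a + Complex.I • b := by
    ext i
    simp [ha_def, hb_def, mul_comm Complex.I, Complex.re_add_im]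
  have hre : ∑ i, (v i).re * (v i).re - ∑ i, (v i).im * (v i).im = 1 := by
    simpa [dotProduct, Finset.sum_sub_distrib] using congrArg Complex.re hv
  have him : a ⬝ᵥ b = 0 := by
    have h : ∑ i, ((v i).re * (v i).im + (v i).im * (v i).re) = 0 := by
      simpa [dotProduct] using congrArg Complex.im hv
    have h2 : ∑ i, (v i).re * (v i).im = 0 := by
      rw [Finset.sum_add_distrib, Finset.sum_congr rfl fun i _ => mul_comm (v i).im (v i).re] at h
      linarith
    simp only [dotProduct, ha_def, hb_def]
    exact_mod_cast h2
  have hsub : a ⬝ᵥ a - b ⬝ᵥ b = 1 := by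
    simp only [dotProduct, ha_def, hb_def]
    exact_mod_cast hre
  have ha0 : a ≠ 0 := by
    intro h
    have h' : ∀ i, (v i).re = 0 := fun i => Complex.ofReal_eq_zero.mp (congrFun h i)
    have := Finset.sum_nonneg fun i (_ : i ∈ Finset.univ) => mul_self_nonneg (v i).im
    simp only [h', mul_zero, Finset.sum_const_zero] at hre
    linarith
  obtain ⟨r, a', hr, ha', haa', hra⟩ := ha.exists_eq_smul_unit ha0
  have hr' : (r : ℂ) ≠ 0 := by exact_mod_cast hr.ne'
  obtain ⟨s, b', hb', hbb', hsb, hab'⟩ : ∃ (s : ℝ) (b' : Fin 8 → ℂ), RealVec b' ∧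
      b' ⬝ᵥ b' = 1 ∧ b = (s : ℂ) • b' ∧ a' ⬝ᵥ b' = 0 := by
    by_cases h : b = 0
    · obtain ⟨b', hb', hbb', hA⟩ := exists_unit_orthogonal (by norm_num) ![a'] (by simpa using ha')
      exact ⟨0, b', hb', hbb', by simp [h], hA 0⟩
    · obtain ⟨s, b', hs, hb', hbb', hsb⟩ := hb.exists_eq_smul_unit h
      have hs' : (s : ℂ) ≠ 0 := by exact_mod_cast hs.ne'
      refine ⟨s, b', hb', hbb', hsb, ?_⟩
      rw [hra, hsb, smul_dotProduct, dotProduct_smul, smul_eq_mul, smul_eq_mul] at him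
      simpa [hr', hs'] using him
  obtain ⟨k, hk, hk0, hk1⟩ := exists_inSpin7_mulVec_pair ha' hb' haa' hbb' hab'
  have hrs : r ^ 2 - s ^ 2 = 1 := by
    rw [hra, hsb] at hsub
    simp only [smul_dotProduct, dotProduct_smul, haa', hbb', smul_eq_mul, mul_one] at hsub
    rw [sq, sq]
    exact_mod_cast hsub
  refine ⟨k, Real.arsinh s, hk, ?_⟩
  have hcosh : Real.cosh (Real.arsinh s) = r := by
    rw [Real.cosh_arsinh, show 1 + s ^ 2 = r ^ 2 by linarith, Real.sqrt_sq hr.le]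
  rw [← mulVec_mulVec, atil_mulVec_e_zero, hcosh, Real.sinh_arsinh, mulVec_add, mulVec_smul,
    mulVec_smul, hk0, hk1, hab, hra, hsb, smul_smul]

/-- **Theorem `thm:cartan-spin7` (Cartan decomposition for Type R-1′).**
For the non-symmetric reductive spherical pair `(Spin(7,ℂ), G₂(ℂ))` of rank-one type:
every `g ∈ B₃(ℂ)` can be written `g = k ã_θ h` with `k ∈ Spin(7)`, `θ ∈ ℝ` and
`h ∈ G₂(ℂ)`.  That is, `Spin(7,ℂ) = Spin(7) · Ã₀ · G₂(ℂ)`. -/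
theorem stmt12 (g : Matrix (Fin 8) (Fin 8) ℂ) (hg : inB3 g) :
    ∃ (k : Matrix (Fin 8) (Fin 8) ℂ) (θ : ℝ) (h : Matrix (Fin 8) (Fin 8) ℂ),
      inSpin7 k ∧ inG2 h ∧ g = k * atil θ * h := by
  obtain ⟨k, θ, hk, hv⟩ := exists_inSpin7_atil_mulVec_e_zero (v := g *ᵥ e 0)
    (by rw [hg.1.mulVec_dotProduct_mulVec, e_zero_dotProduct]; simp [e])
  have hB : inB3 (k * atil θ) := hk.inB3.mul (atil_inB3 θ)
  refine ⟨k, θ, (k * atil θ)ᵀ * g, hk, (hB.transpose.mul hg).inG2 ?_, ?_⟩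
  · rw [← mulVec_mulVec, ← hv, hB.1.transpose_mulVec_mulVec]
  · rw [← Matrix.mul_assoc, hB.1.mul_transpose, Matrix.one_mul]
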